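/- arXiv:2512.24293 — 10 statements merged into one kernel-verified Lean document; each statement's English description precedes it below -/
import Mathlib

section
/- Let G be a finite simple graph admitting a positive quasi neighborhood balanced coloring, and let k denote the number of vertices of G of odd degree. Then 2|E(G)| ≡ −k (mod 4). -/
open SimpleGraph

/-- Number of neighbors of `v` in `G` that receive color `col` under the
2-coloring `c` (`true` = red, `false` = blue). -/
noncomputable def nbrCount {V : Type*} (G : SimpleGraph V) (c : V → Bool) (col : Bool) (v : V) : ℕ :=
  {u | G.Adj v u ∧ c u = col}.ncard

/-- A quasi neighborhood balanced coloring: every vertex has red/blue neighbor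
counts differing by at most one, and some vertex has difference exactly one. -/
def IsQNBC {V : Type*} (G : SimpleGraph V) (c : V → Bool) : Prop :=
  (∀ v, |(nbrCount G c true v : ℤ) - (nbrCount G c false v : ℤ)| ≤ 1) ∧
  (∃ v, |(nbrCount G c true v : ℤ) - (nbrCount G c false v : ℤ)| = 1)

/-- A neighborhood balanced coloring: every vertex has equally many red and
blue neighbors. -/
def IsNBC {V : Type*} (G : SimpleGraph V) (c : V → Bool) : Prop :=
  ∀ v, nbrCount G c true v = nbrCount G c false v

/-- A positive QNBC: every imbalanced vertex has one more neighbor of its own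
color than of the opposite color. -/
def IsPosQNBC {V : Type*} (G : SimpleGraph V) (c : V → Bool) : Prop :=
  IsQNBC G c ∧
  ∀ v, |(nbrCount G c true v : ℤ) - (nbrCount G c false v : ℤ)| = 1 →
    nbrCount G c (c v) v = nbrCount G c (!(c v)) v + 1

/-- A negative QNBC: every imbalanced vertex has one more neighbor of the
opposite color than of its own color. -/
def IsNegQNBC {V : Type*} (G : SimpleGraph V) (c : V → Bool) : Prop :=
  IsQNBC G c ∧
  ∀ v, |(nbrCount G c true v : ℤ) - (nbrCount G c false v : ℤ)| = 1 →
    nbrCount G c (!(c v)) v = nbrCount G c (c v) v + 1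

/-- A uniform QNBC: there is a single color `col` such that every imbalanced
vertex has one more neighbor of color `col` than of the other color. -/
def IsUniformQNBC {V : Type*} (G : SimpleGraph V) (c : V → Bool) : Prop :=
  IsQNBC G c ∧
  ∃ col : Bool, ∀ v, |(nbrCount G c true v : ℤ) - (nbrCount G c false v : ℤ)| = 1 →
    nbrCount G c col v = nbrCount G c (!col) v + 1

/-- The spanning subgraph of `G` whose edges join vertices of the same color. -/
def monochromaticSubgraph {V : Type*} (G : SimpleGraph V) (c : V → Bool) : SimpleGraph V where
  Adj u v := G.Adj u v ∧ c v = c u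
  symm := ⟨fun _ _ h => ⟨h.1.symm, h.2.symm⟩⟩
  loopless := ⟨fun v h => G.loopless.irrefl v h.1⟩

theorem nbrCount_add_nbrCount_not {V : Type*} [Finite V] (G : SimpleGraph V) (c : V → Bool)
    (col : Bool) (v : V) :
    nbrCount G c col v + nbrCount G c (!col) v = (G.neighborSet v).ncard := by
  unfold nbrCount
  rw [← Set.ncard_union_eq _ (Set.toFinite _) (Set.toFinite _)]
  · congr 1
    ext u
    cases h : c u <;> cases col <;> simp [h]
  · rw [Set.disjoint_left]
    rintro u ⟨_, h₁⟩ ⟨_, h₂⟩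
    cases col <;> simp_all

open Classical in
/-- In a positive QNBC exactly the odd-degree vertices are imbalanced, each in favor of its own
color. -/
theorem IsPosQNBC.ncard_neighborSet_add {V : Type*} [Finite V] {G : SimpleGraph V}
    {c : V → Bool} (h : IsPosQNBC G c) (v : V) :
    (G.neighborSet v).ncard + (if Odd (G.neighborSet v).ncard then 1 else 0) =
      2 * nbrCount G c (c v) v := by
  have hle := h.1.1 v
  have himb := h.2 v
  rw [← nbrCount_add_nbrCount_not G c (c v) v]
  by_cases hd : |(nbrCount G c true v : ℤ) - (nbrCount G c false v : ℤ)| = 1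
  · have hown := himb hd
    rw [if_pos (Nat.odd_iff.2 (by omega))]
    omega
  · have heq : nbrCount G c (c v) v = nbrCount G c (!(c v)) v := by
      cases c v <;> simp only [Bool.not_true, Bool.not_false] <;> grind
    rw [if_neg (by rw [Nat.odd_iff]; omega)]
    omega

theorem sum_ncard_neighborSet {V : Type*} [Fintype V] (G : SimpleGraph V) :
    ∑ v, (G.neighborSet v).ncard = 2 * G.edgeSet.ncard := by
  classical
  rw [← coe_edgeFinset G, Set.ncard_coe_finset, ← sum_degrees_eq_twice_card_edges]
  refine Finset.sum_congr rfl fun v _ => ?_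
  rw [Set.ncard_eq_toFinset_card', ← neighborFinset_def, card_neighborFinset_eq_degree]

theorem stmt_1 {V : Type*} [Fintype V] (G : SimpleGraph V) (c : V → Bool)
    (h : IsPosQNBC G c) :
    (2 * (G.edgeSet.ncard : ℤ)) ≡
      -(({v : V | Odd (G.neighborSet v).ncard}.ncard : ℤ)) [ZMOD 4] := by
  classical
  have hodd : {v : V | Odd (G.neighborSet v).ncard}.ncard =
      ∑ v, if Odd (G.neighborSet v).ncard then 1 else 0 := by
    rw [← Finset.card_filter, ← Set.ncard_coe_finset]
    simp
  have hsum := Finset.sum_congr (s₁ := Finset.univ) rfl fun v _ => h.ncard_neighborSet_add v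
  have hmono : ∑ v, nbrCount G c (c v) v = 2 * (monochromaticSubgraph G c).edgeSet.ncard :=
    sum_ncard_neighborSet (monochromaticSubgraph G c)
  rw [Finset.sum_add_distrib, sum_ncard_neighborSet, ← Finset.mul_sum, hmono, ← hodd] at hsum
  rw [Int.modEq_iff_dvd]
  omega
end

section
/- For all positive integers n and d with 1 ≤ d ≤ (n−1)/2, the generalized Petersen graph GP(n,d) admits a positive quasi neighborhood balanced coloring. -/
open SimpleGraph

/-- The generalized Petersen graph `GP n d`: outer vertices `Sum.inl i`
forming a cycle, inner vertices `Sum.inr i` with spokes `vᵢuᵢ` and inner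
edges `uᵢu_{i+d}`, indices modulo `n`. -/
def GP (n d : ℕ) : SimpleGraph (ZMod n ⊕ ZMod n) :=
  SimpleGraph.fromRel (fun x y =>
    match x, y with
    | Sum.inl i, Sum.inl j => j = i + 1
    | Sum.inl i, Sum.inr j => j = i
    | Sum.inr i, Sum.inr j => j = i + (d : ZMod n)
    | _, _ => False)

theorem nbrCount_isLeft_eq_two {n d : ℕ} (h1 : (2 : ZMod n) ≠ 0) (hd : (2 * d : ZMod n) ≠ 0)
    (v : ZMod n ⊕ ZMod n) : nbrCount (GP n d) Sum.isLeft v.isLeft v = 2 := by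
  have h1' : (1 : ZMod n) ≠ 0 := fun h => h1 (by linear_combination 2 * h)
  have hd' : (d : ZMod n) ≠ 0 := fun h => hd (by linear_combination 2 * h)
  rcases v with i | i
  · rw [nbrCount, Set.ncard_eq_two]
    refine ⟨Sum.inl (i + 1), Sum.inl (i - 1), ?_, ?_⟩
    · rw [Ne, Sum.inl.injEq]
      exact fun h => h1 (by linear_combination h)
    · ext (j | j)
      · simp only [GP, SimpleGraph.fromRel_adj, Set.mem_ofPred_eq, Set.mem_insert_iff,
          Set.mem_singleton_iff, Sum.inl.injEq, ne_eq, Sum.isLeft_inl, and_true, eq_sub_iff_add_eq]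
        grind
      · simp
  · rw [nbrCount, Set.ncard_eq_two]
    refine ⟨Sum.inr (i + d), Sum.inr (i - d), ?_, ?_⟩
    · rw [Ne, Sum.inr.injEq]
      exact fun h => hd (by linear_combination h)
    · ext (j | j)
      · simp
      · simp only [GP, SimpleGraph.fromRel_adj, Set.mem_ofPred_eq, Set.mem_insert_iff,
          Set.mem_singleton_iff, Sum.inr.injEq, ne_eq, Sum.isLeft_inr, and_true, eq_sub_iff_add_eq]
        grind

theorem nbrCount_not_isLeft_eq_one (n d : ℕ) (v : ZMod n ⊕ ZMod n) :
    nbrCount (GP n d) Sum.isLeft (!v.isLeft) v = 1 := by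
  rw [nbrCount, Set.ncard_eq_one]
  refine ⟨v.swap, ?_⟩
  rcases v with i | i <;> ext (j | j) <;> simp [GP, eq_comm (a := j)]

theorem stmt_4 (n d : ℕ) (hd : 1 ≤ d) (hdn : d ≤ (n - 1) / 2) :
    ∃ c : ZMod n ⊕ ZMod n → Bool, IsPosQNBC (GP n d) c := by
  have h1 : (2 : ZMod n) ≠ 0 := fun h => by
    have := Nat.le_of_dvd two_pos ((ZMod.natCast_eq_zero_iff 2 n).1 (by exact_mod_cast h))
    omega
  have h2 : (2 * d : ZMod n) ≠ 0 := fun h => by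
    have := Nat.le_of_dvd (by omega) ((ZMod.natCast_eq_zero_iff (2 * d) n).1 (by exact_mod_cast h))
    omega
  have key (v : ZMod n ⊕ ZMod n) :
      |(nbrCount (GP n d) Sum.isLeft true v : ℤ) - (nbrCount (GP n d) Sum.isLeft false v : ℤ)|
        = 1 := by
    have ht := nbrCount_isLeft_eq_two h1 h2 v
    have hf := nbrCount_not_isLeft_eq_one n d v
    rcases v with i | i <;> simp_all
  refine ⟨Sum.isLeft, ⟨fun v => (key v).le, Sum.inl 0, key _⟩, fun v _ => ?_⟩
  rw [nbrCount_isLeft_eq_two h1 h2, nbrCount_not_isLeft_eq_one]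
end

section
/- For every n ≥ 2, the path P_n on n vertices admits a quasi neighborhood balanced coloring. -/
open SimpleGraph

/-- If distinct neighbors of `v` always get distinct colors, each color occurs at most once
around `v`. -/
theorem nbrCount_le_one {V : Type*} [Finite V] {G : SimpleGraph V} {c : V → Bool} {v : V}
    (h : ∀ u w, G.Adj v u → G.Adj v w → c u = c w → u = w) (col : Bool) :
    nbrCount G c col v ≤ 1 := by
  unfold nbrCount
  rw [Set.ncard_le_one (Set.toFinite _)]
  rintro u ⟨hu, hcu⟩ w ⟨hw, hcw⟩
  exact h u w hu hw (hcu.trans hcw.symm)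

theorem stmt_6 (n : ℕ) (hn : 2 ≤ n) :
    ∃ c : Fin n → Bool, IsQNBC (SimpleGraph.pathGraph n) c := by
  refine ⟨fun i => decide (i.val % 4 < 2), fun v => ?_, ⟨0, by omega⟩, ?_⟩
  · have key := nbrCount_le_one (G := SimpleGraph.pathGraph n)
      (c := fun i => decide (i.val % 4 < 2)) (v := v) (fun u w hu hw huw => by
        rw [SimpleGraph.pathGraph_adj] at hu hw
        rw [decide_eq_decide] at huw
        apply Fin.ext
        omega)
    have ht := key true
    have hf := key false
    rw [abs_le]
    omega
  · have ht : nbrCount (SimpleGraph.pathGraph n) (fun i => decide (i.val % 4 < 2)) true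
        ⟨0, by omega⟩ = 1 := by
      unfold nbrCount
      rw [Set.ncard_eq_one]
      refine ⟨⟨1, by omega⟩, ?_⟩
      ext u
      simp only [SimpleGraph.pathGraph_adj, Set.mem_ofPred_eq, Set.mem_singleton_iff, Fin.ext_iff,
        decide_eq_true_eq]
      omega
    have hf : nbrCount (SimpleGraph.pathGraph n) (fun i => decide (i.val % 4 < 2)) false
        ⟨0, by omega⟩ = 0 := by
      unfold nbrCount
      rw [Set.ncard_eq_zero (Set.toFinite _)]
      ext u
      simp only [SimpleGraph.pathGraph_adj, Set.mem_ofPred_eq, Set.mem_empty_iff_false,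
        decide_eq_false_iff_not, iff_false]
      omega
    rw [ht, hf]
    norm_num
end

section
/- For n ≥ 2, the path P_n on n vertices admits a uniform quasi neighborhood balanced coloring if and only if n is not congruent to 1 modulo 4. -/
open SimpleGraph

theorem nbrCount_of_adj_iff_eq {V : Type*} {G : SimpleGraph V} {v u : V}
    (h : ∀ x, G.Adj v x ↔ x = u) (c : V → Bool) (col : Bool) :
    nbrCount G c col v = if c u = col then 1 else 0 := by
  unfold nbrCount
  split_ifs with hu
  · rw [Set.ncard_eq_one]
    exact ⟨u, by ext x; simp only [h, Set.mem_ofPred_eq, Set.mem_singleton_iff]; grind⟩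
  · have : {x | G.Adj v x ∧ c x = col} = ∅ := by
      ext x; simp only [h, Set.mem_ofPred_eq, Set.mem_empty_iff_false]; grind
    rw [this, Set.ncard_empty]

theorem nbrCount_of_adj_iff_eq_or_eq {V : Type*} {G : SimpleGraph V} {v u w : V} (huw : u ≠ w)
    (h : ∀ x, G.Adj v x ↔ x = u ∨ x = w) (c : V → Bool) (col : Bool) :
    nbrCount G c col v = (if c u = col then 1 else 0) + if c w = col then 1 else 0 := by
  classical
  have : {x | G.Adj v x ∧ c x = col} = (({u, w} : Finset V).filter (c · = col) : Set V) := by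
    ext x; simp [h]
  rw [nbrCount, this, Set.ncard_coe_finset, Finset.card_filter, Finset.sum_pair huw]

theorem nbrCount_pathGraph_first {n : ℕ} (hn : 2 ≤ n) (c : Fin n → Bool) (col : Bool) :
    nbrCount (pathGraph n) c col ⟨0, by omega⟩ = if c ⟨1, hn⟩ = col then 1 else 0 :=
  nbrCount_of_adj_iff_eq (fun x => by simp only [pathGraph_adj, Fin.ext_iff]; omega) c col

theorem nbrCount_pathGraph_last {n : ℕ} (hn : 2 ≤ n) (c : Fin n → Bool) (col : Bool) :
    nbrCount (pathGraph n) c col ⟨n - 1, by omega⟩ =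
      if c ⟨n - 2, by omega⟩ = col then 1 else 0 :=
  nbrCount_of_adj_iff_eq (fun x => by simp only [pathGraph_adj, Fin.ext_iff]; omega) c col

theorem nbrCount_pathGraph_interior {n i : ℕ} (hi : i + 2 < n) (c : Fin n → Bool) (col : Bool) :
    nbrCount (pathGraph n) c col ⟨i + 1, by omega⟩ =
      (if c ⟨i, by omega⟩ = col then 1 else 0) + if c ⟨i + 2, hi⟩ = col then 1 else 0 :=
  nbrCount_of_adj_iff_eq_or_eq (by simp [Fin.ext_iff])
    (fun x => by simp only [pathGraph_adj, Fin.ext_iff]; omega) c col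

/-- A coloring of a path is a uniform QNBC iff vertices at distance two differ in color and the
neighbors of the two ends agree. -/
theorem isUniformQNBC_pathGraph_iff {n : ℕ} (hn : 2 ≤ n) (c : Fin n → Bool) :
    IsUniformQNBC (pathGraph n) c ↔
      (∀ i (hi : i + 2 < n), c ⟨i + 2, hi⟩ = !c ⟨i, by omega⟩) ∧
        c ⟨1, hn⟩ = c ⟨n - 2, by omega⟩ := by
  constructor
  · rintro ⟨⟨hle, -⟩, col, hcol⟩
    refine ⟨fun i hi => ?_, ?_⟩
    · have := hle ⟨i + 1, by omega⟩
      rw [nbrCount_pathGraph_interior hi, nbrCount_pathGraph_interior hi] at this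
      revert this
      cases c ⟨i, by omega⟩ <;> cases c ⟨i + 2, hi⟩ <;> simp
    · have h₀ := hcol ⟨0, by omega⟩
      have h₁ := hcol ⟨n - 1, by omega⟩
      simp only [nbrCount_pathGraph_first hn] at h₀
      simp only [nbrCount_pathGraph_last hn] at h₁
      revert h₀ h₁
      cases c ⟨1, hn⟩ <;> cases c ⟨n - 2, by omega⟩ <;> cases col <;> simp
  · rintro ⟨hstep, hends⟩
    have hcases (v : Fin n) : v = ⟨0, by omega⟩ ∨ v = ⟨n - 1, by omega⟩ ∨
        ∃ i, ∃ hi : i + 2 < n, v = ⟨i + 1, by omega⟩ := by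
      by_cases h₀ : v.val = 0
      · exact .inl (Fin.ext h₀)
      by_cases h₁ : v.val = n - 1
      · exact .inr (.inl (Fin.ext h₁))
      exact .inr (.inr ⟨v - 1, by omega, Fin.ext (by simp only; omega)⟩)
    refine ⟨⟨fun v => ?_, ⟨0, by omega⟩, ?_⟩, c ⟨1, hn⟩, fun v => ?_⟩
    · obtain rfl | rfl | ⟨i, hi, rfl⟩ := hcases v
      · simp only [nbrCount_pathGraph_first hn]
        cases c ⟨1, hn⟩ <;> simp
      · simp only [nbrCount_pathGraph_last hn]
        cases c ⟨n - 2, by omega⟩ <;> simp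
      · simp only [nbrCount_pathGraph_interior hi, hstep i hi]
        cases c ⟨i, by omega⟩ <;> simp
    · simp only [nbrCount_pathGraph_first hn]
      cases c ⟨1, hn⟩ <;> simp
    · obtain rfl | rfl | ⟨i, hi, rfl⟩ := hcases v
      · simp [nbrCount_pathGraph_first hn]
      · simp [nbrCount_pathGraph_last hn, hends]
      · simp only [nbrCount_pathGraph_interior hi, hstep i hi]
        cases c ⟨i, by omega⟩ <;> simp

theorem stmt_7 (n : ℕ) (hn : 2 ≤ n) :
    (∃ c : Fin n → Bool, IsUniformQNBC (SimpleGraph.pathGraph n) c) ↔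
      n % 4 ≠ 1 := by
  simp only [isUniformQNBC_pathGraph_iff hn]
  constructor
  · rintro ⟨c, hstep, hends⟩ hmod
    have hperiod (k : ℕ) (hk : 4 * k + 3 < n) : c ⟨4 * k + 3, hk⟩ = !c ⟨1, hn⟩ := by
      induction k with
      | zero => exact hstep 1 hk
      | succ k ih =>
        have h₁ := hstep (4 * k + 3) (by omega)
        have h₂ := hstep (4 * k + 5) (by omega)
        rw [ih (by omega)] at h₁
        rw [h₁, Bool.not_not] at h₂
        exact h₂
    have hlast : n - 2 = 4 * (n / 4 - 1) + 3 := by omega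
    simp only [hlast, hperiod (n / 4 - 1) (by omega)] at hends
    simp at hends
  · intro hmod
    obtain ⟨t, ht, hn'⟩ : ∃ t, (t = 0 ∨ t = 2) ∧ (n % 4 = 3 ∨ (n - 2) % 4 = t) := by
      by_cases h : n % 4 = 2
      · exact ⟨0, by omega⟩
      · exact ⟨2, by omega⟩
    refine ⟨fun i => decide (i.val % 4 = 1 ∨ i.val % 4 = t), fun i hi => ?_, ?_⟩
    · rw [← decide_not, decide_eq_decide]
      dsimp only
      omega
    · rw [decide_eq_decide]
      dsimp only
      omega
end

section
/- For all positive integers m and n, the bistar B_{m,n} admits a uniform quasi neighborhood balanced coloring. -/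
open SimpleGraph

/-- The bistar `B_{m,n}`: centers `Sum.inl 0 = a` and `Sum.inl 1 = b` joined
by an edge, `a` adjacent to `m` pendant vertices and `b` adjacent to `n`
pendant vertices. -/
def Bistar (m n : ℕ) : SimpleGraph (Fin 2 ⊕ (Fin m ⊕ Fin n)) :=
  SimpleGraph.fromRel (fun x y =>
    match x, y with
    | Sum.inl i, Sum.inl j => i ≠ j
    | Sum.inl i, Sum.inr (Sum.inl _) => i = 0
    | Sum.inl i, Sum.inr (Sum.inr _) => i = 1
    | _, _ => False)

/-- Both centers are red, and so is the first half (rounded down) of each set of leaves. -/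
def bistarColoring (m n : ℕ) : Fin 2 ⊕ (Fin m ⊕ Fin n) → Bool
  | Sum.inl _ => true
  | Sum.inr (Sum.inl i) => decide (i.val < m / 2)
  | Sum.inr (Sum.inr j) => decide (j.val < n / 2)

open Classical in
lemma nbrCount_eq_sum {V : Type*} [Fintype V] (G : SimpleGraph V) (c : V → Bool) (col : Bool)
    (v : V) : nbrCount G c col v = ∑ u, if G.Adj v u ∧ c u = col then 1 else 0 := by
  rw [nbrCount, Set.ncard_eq_toFinset_card', Set.toFinset_ofPred, Finset.card_filter]

lemma card_filter_val_lt_half (k : ℕ) : Finset.card {i : Fin k | i.val < k / 2} = k / 2 := by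
  rw [Fin.card_filter_val_lt]
  omega

lemma card_filter_half_le_val (k : ℕ) : Finset.card {i : Fin k | k / 2 ≤ i.val} = k - k / 2 := by
  have h := Finset.card_filter_add_card_filter_not (s := (Finset.univ : Finset (Fin k)))
    (fun i => i.val < k / 2)
  simp only [not_lt, card_filter_val_lt_half, Finset.card_univ, Fintype.card_fin] at h
  omega

lemma nbrCount_bistar_left (m n : ℕ) :
    nbrCount (Bistar m n) (bistarColoring m n) true (Sum.inl 0) = m / 2 + 1 ∧
    nbrCount (Bistar m n) (bistarColoring m n) false (Sum.inl 0) = m - m / 2 := by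
  constructor
  all_goals
    simp only [nbrCount_eq_sum, Fintype.sum_sum_type, Fin.sum_univ_two]
    simp [Bistar, bistarColoring, card_filter_val_lt_half, card_filter_half_le_val, add_comm]

lemma nbrCount_bistar_right (m n : ℕ) :
    nbrCount (Bistar m n) (bistarColoring m n) true (Sum.inl 1) = n / 2 + 1 ∧
    nbrCount (Bistar m n) (bistarColoring m n) false (Sum.inl 1) = n - n / 2 := by
  constructor
  all_goals
    simp only [nbrCount_eq_sum, Fintype.sum_sum_type, Fin.sum_univ_two]
    simp [Bistar, bistarColoring, card_filter_val_lt_half, card_filter_half_le_val, add_comm]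

lemma nbrCount_bistar_leaf (m n : ℕ) (x : Fin m ⊕ Fin n) :
    nbrCount (Bistar m n) (bistarColoring m n) true (Sum.inr x) = 1 ∧
    nbrCount (Bistar m n) (bistarColoring m n) false (Sum.inr x) = 0 := by
  rcases x with i | j <;> constructor <;> simp [nbrCount_eq_sum, Bistar, bistarColoring]

lemma nbrCount_bistar_balance (m n : ℕ) (v : Fin 2 ⊕ (Fin m ⊕ Fin n)) :
    nbrCount (Bistar m n) (bistarColoring m n) true v =
      nbrCount (Bistar m n) (bistarColoring m n) false v ∨
    nbrCount (Bistar m n) (bistarColoring m n) true v =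
      nbrCount (Bistar m n) (bistarColoring m n) false v + 1 := by
  rcases v with i | x
  · fin_cases i
    · have := nbrCount_bistar_left m n
      simp only [Fin.zero_eta]
      omega
    · have := nbrCount_bistar_right m n
      simp only [Fin.mk_one]
      omega
  · have := nbrCount_bistar_leaf m n x
    omega

theorem stmt_8 (m n : ℕ) (hm : 1 ≤ m) (hn : 1 ≤ n) :
    ∃ c : Fin 2 ⊕ (Fin m ⊕ Fin n) → Bool, IsUniformQNBC (Bistar m n) c := by
  refine ⟨bistarColoring m n, ⟨fun v => ?_, Sum.inr (Sum.inl ⟨0, hm⟩), ?_⟩, true, fun v hv => ?_⟩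
  · rcases nbrCount_bistar_balance m n v with h | h <;> simp [h]
  · simp [nbrCount_bistar_leaf]
  · rcases nbrCount_bistar_balance m n v with h | h
    · simp [h] at hv
    · exact h
end

section
/- Let G and H be finite simple graphs with G nonempty (having at least one vertex). If H admits a quasi neighborhood balanced coloring c in which the number of red vertices equals the number of blue vertices, then the lexicographic product G[H] admits a quasi neighborhood balanced coloring. -/
open SimpleGraph

/-- The lexicographic product `G[H]`. -/
def lexProd {V W : Type*} (G : SimpleGraph V) (H : SimpleGraph W) :
    SimpleGraph (V × W) :=
  SimpleGraph.fromRel (fun x y =>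
    G.Adj x.1 y.1 ∨ (x.1 = y.1 ∧ H.Adj x.2 y.2))

theorem lexProd_adj {V W : Type*} (G : SimpleGraph V) (H : SimpleGraph W) (x y : V × W) :
    (lexProd G H).Adj x y ↔ G.Adj x.1 y.1 ∨ (x.1 = y.1 ∧ H.Adj x.2 y.2) := by
  simp only [lexProd, SimpleGraph.fromRel_adj]
  constructor
  · rintro ⟨-, h | h⟩
    · exact h
    · exact h.imp SimpleGraph.Adj.symm fun h => ⟨h.1.symm, h.2.symm⟩
  · intro h
    refine ⟨?_, Or.inl h⟩
    rintro rfl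
    exact h.elim G.irrefl fun h => H.irrefl h.2

/-- Coloring every copy of `H` in `G[H]` by `c`, the neighbors of `v` of a given color are those in
its own copy of `H` and the whole color class in each neighboring copy. -/
theorem nbrCount_lexProd_comp_snd {V W : Type*} [Finite V] [Finite W] (G : SimpleGraph V)
    (H : SimpleGraph W) (c : W → Bool) (col : Bool) (v : V × W) :
    nbrCount (lexProd G H) (c ∘ Prod.snd) col v =
      (G.neighborSet v.1).ncard * {w | c w = col}.ncard + nbrCount H c col v.2 := by
  have hunion : {u | (lexProd G H).Adj v u ∧ (c ∘ Prod.snd) u = col} =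
      G.neighborSet v.1 ×ˢ {w | c w = col} ∪ {v.1} ×ˢ {w | H.Adj v.2 w ∧ c w = col} := by
    ext u
    simp only [lexProd_adj, Function.comp_apply, Set.mem_ofPred_eq, Set.mem_union, Set.mem_prod,
      SimpleGraph.mem_neighborSet, Set.mem_singleton_iff, eq_comm (a := u.1)]
    tauto
  have hdisj : Disjoint (G.neighborSet v.1 ×ˢ {w | c w = col})
      ({v.1} ×ˢ {w | H.Adj v.2 w ∧ c w = col}) :=
    Set.Disjoint.set_prod_left (by simp) _ _
  rw [nbrCount, hunion, Set.ncard_union_eq hdisj, Set.ncard_prod, Set.ncard_prod,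
    Set.ncard_singleton, one_mul, nbrCount]

theorem stmt_9 {V W : Type*} [Fintype V] [Fintype W] [Nonempty V]
    (G : SimpleGraph V) (H : SimpleGraph W) (c : W → Bool)
    (hc : IsQNBC H c)
    (hbal : {w : W | c w = true}.ncard = {w : W | c w = false}.ncard) :
    ∃ c' : V × W → Bool, IsQNBC (lexProd G H) c' := by
  have hdiff (v : V × W) :
      (nbrCount (lexProd G H) (c ∘ Prod.snd) true v : ℤ) -
        nbrCount (lexProd G H) (c ∘ Prod.snd) false v =
      nbrCount H c true v.2 - nbrCount H c false v.2 := by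
    rw [nbrCount_lexProd_comp_snd, nbrCount_lexProd_comp_snd, hbal]
    push_cast
    ring
  obtain ⟨hle, w, hw⟩ := hc
  refine ⟨c ∘ Prod.snd, fun v => ?_, (Classical.arbitrary V, w), ?_⟩
  · rw [hdiff]
    exact hle v.2
  · rw [hdiff]
    exact hw
end

section
/- Let G and H be finite simple graphs. If G admits a quasi neighborhood balanced coloring and H admits a neighborhood balanced coloring, then the direct product G × H admits a neighborhood balanced coloring. -/
open SimpleGraph

/-- The direct (tensor) product `G × H`. -/
def tensorProd {V W : Type*} (G : SimpleGraph V) (H : SimpleGraph W) :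
    SimpleGraph (V × W) :=
  SimpleGraph.fromRel (fun x y => G.Adj x.1 y.1 ∧ H.Adj x.2 y.2)

theorem tensorProd_adj {V W : Type*} (G : SimpleGraph V) (H : SimpleGraph W) (x y : V × W) :
    (tensorProd G H).Adj x y ↔ G.Adj x.1 y.1 ∧ H.Adj x.2 y.2 := by
  rw [tensorProd, SimpleGraph.fromRel_adj]
  constructor
  · rintro ⟨-, h | h⟩
    · exact h
    · exact ⟨h.1.symm, h.2.symm⟩
  · intro h
    exact ⟨fun hxy => h.1.ne (congrArg Prod.fst hxy), Or.inl h⟩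

theorem nbrCount_tensorProd_snd {V W : Type*} (G : SimpleGraph V) (H : SimpleGraph W)
    (h : W → Bool) (col : Bool) (x : V × W) :
    nbrCount (tensorProd G H) (fun y => h y.2) col x =
      (G.neighborSet x.1).ncard * nbrCount H h col x.2 := by
  rw [nbrCount, nbrCount, ← Set.ncard_prod]
  congr 1
  ext y
  simp [tensorProd_adj, and_assoc]

theorem stmt_11 {V W : Type*} [Fintype V] [Fintype W]
    (G : SimpleGraph V) (H : SimpleGraph W)
    (hG : ∃ g : V → Bool, IsQNBC G g)
    (hH : ∃ h : W → Bool, IsNBC H h) :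
    ∃ c : V × W → Bool, IsNBC (tensorProd G H) c := by
  obtain ⟨h, hh⟩ := hH
  exact ⟨fun y => h y.2, fun x => by simp only [nbrCount_tensorProd_snd, hh x.2]⟩
end

section
/- Let G and H be finite simple graphs. If both G and H admit quasi neighborhood balanced colorings, then the direct product G × H admits a quasi neighborhood balanced coloring. -/
open SimpleGraph

/-- The signed imbalance of a coloring at `v` is the sum of the signs of the neighbors of `v`. -/
theorem nbrCount_sub_nbrCount {V : Type*} [Fintype V] (G : SimpleGraph V) [DecidableRel G.Adj]
    (c : V → Bool) (v : V) :
    (nbrCount G c true v : ℤ) - (nbrCount G c false v : ℤ) =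
      ∑ u, if G.Adj v u then (if c u then 1 else -1) else 0 := by
  have hcount (col : Bool) :
      (nbrCount G c col v : ℤ) = ∑ u, if G.Adj v u ∧ c u = col then 1 else 0 := by
    rw [nbrCount, Set.ncard_eq_toFinset_card', Finset.sum_boole, Set.toFinset_ofPred]
  rw [hcount, hcount, ← Finset.sum_sub_distrib]
  refine Finset.sum_congr rfl fun u _ => ?_
  by_cases hadj : G.Adj v u <;> cases c u <;> simp [hadj]

/-- Imbalances multiply under the direct product, when vertices are colored by agreement. -/
theorem nbrCount_sub_nbrCount_tensorProd {V W : Type*} [Fintype V] [Fintype W]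
    (G : SimpleGraph V) (H : SimpleGraph W) (g : V → Bool) (h : W → Bool) (x : V × W) :
    (nbrCount (tensorProd G H) (fun y => g y.1 == h y.2) true x : ℤ) -
        (nbrCount (tensorProd G H) (fun y => g y.1 == h y.2) false x : ℤ) =
      ((nbrCount G g true x.1 : ℤ) - (nbrCount G g false x.1 : ℤ)) *
        ((nbrCount H h true x.2 : ℤ) - (nbrCount H h false x.2 : ℤ)) := by
  classical
  rw [nbrCount_sub_nbrCount, nbrCount_sub_nbrCount, nbrCount_sub_nbrCount,
    Finset.sum_mul_sum, Fintype.sum_prod_type]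
  refine Finset.sum_congr rfl fun u _ => Finset.sum_congr rfl fun w _ => ?_
  by_cases hG : G.Adj x.1 u <;> by_cases hH : H.Adj x.2 w <;>
    cases g u <;> cases h w <;> simp [tensorProd_adj, hG, hH]

theorem stmt_12 {V W : Type*} [Fintype V] [Fintype W]
    (G : SimpleGraph V) (H : SimpleGraph W)
    (hG : ∃ g : V → Bool, IsQNBC G g)
    (hH : ∃ h : W → Bool, IsQNBC H h) :
    ∃ c : V × W → Bool, IsQNBC (tensorProd G H) c := by
  obtain ⟨g, hg, v, hv⟩ := hG
  obtain ⟨h, hh, w, hw⟩ := hH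
  refine ⟨fun y => g y.1 == h y.2, fun x => ?_, (v, w), ?_⟩
  · rw [nbrCount_sub_nbrCount_tensorProd, abs_mul]
    exact mul_le_one₀ (hg x.1) (abs_nonneg _) (hh x.2)
  · rw [nbrCount_sub_nbrCount_tensorProd, abs_mul, hv, hw, one_mul]
end

section
/- Let G and H be finite simple graphs. If G admits a quasi neighborhood balanced coloring g in which the number of red vertices equals the number of blue vertices, and H admits a quasi neighborhood balanced coloring h in which the number of red vertices equals the number of blue vertices, then the join G ∨ H admits a quasi neighborhood balanced coloring. -/
open SimpleGraph

/-- The join `G ∨ H`: disjoint union of `G` and `H` together with all edges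
between them. -/
def joinGraph {V W : Type*} (G : SimpleGraph V) (H : SimpleGraph W) :
    SimpleGraph (V ⊕ W) :=
  SimpleGraph.fromRel (fun x y =>
    match x, y with
    | Sum.inl a, Sum.inl b => G.Adj a b
    | Sum.inr a, Sum.inr b => H.Adj a b
    | _, _ => True)

theorem joinGraph_adj_inl_inl {V W : Type*} (G : SimpleGraph V) (H : SimpleGraph W) (a b : V) :
    (joinGraph G H).Adj (Sum.inl a) (Sum.inl b) ↔ G.Adj a b := by
  simp only [joinGraph, SimpleGraph.fromRel_adj, ne_eq, Sum.inl.injEq]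
  exact ⟨fun hab => hab.2.elim id fun hba => hba.symm, fun hab => ⟨hab.ne, Or.inl hab⟩⟩

theorem joinGraph_adj_inr_inr {V W : Type*} (G : SimpleGraph V) (H : SimpleGraph W) (a b : W) :
    (joinGraph G H).Adj (Sum.inr a) (Sum.inr b) ↔ H.Adj a b := by
  simp only [joinGraph, SimpleGraph.fromRel_adj, ne_eq, Sum.inr.injEq]
  exact ⟨fun hab => hab.2.elim id fun hba => hba.symm, fun hab => ⟨hab.ne, Or.inl hab⟩⟩

theorem joinGraph_adj_inl_inr {V W : Type*} (G : SimpleGraph V) (H : SimpleGraph W)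
    (a : V) (b : W) : (joinGraph G H).Adj (Sum.inl a) (Sum.inr b) := by
  simp [joinGraph]

theorem Set.ncard_sum {V W : Type*} [Finite V] [Finite W] (s : Set (V ⊕ W)) :
    s.ncard = (Sum.inl ⁻¹' s).ncard + (Sum.inr ⁻¹' s).ncard := by
  rw [← Set.ncard_image_of_injective (Sum.inl ⁻¹' s) (Sum.inl_injective (β := W)),
    ← Set.ncard_image_of_injective (Sum.inr ⁻¹' s) (Sum.inr_injective (α := V)),
    ← Set.ncard_union_eq Set.disjoint_image_inl_image_inr,
    Set.image_preimage_inl_union_image_preimage_inr]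

theorem nbrCount_joinGraph_inl {V W : Type*} [Finite V] [Finite W]
    (G : SimpleGraph V) (H : SimpleGraph W) (g : V → Bool) (h : W → Bool) (col : Bool) (v : V) :
    nbrCount (joinGraph G H) (Sum.elim g h) col (Sum.inl v) =
      nbrCount G g col v + {w | h w = col}.ncard := by
  simp [nbrCount, Set.ncard_sum, joinGraph_adj_inl_inl, joinGraph_adj_inl_inr]

theorem nbrCount_joinGraph_inr {V W : Type*} [Finite V] [Finite W]
    (G : SimpleGraph V) (H : SimpleGraph W) (g : V → Bool) (h : W → Bool) (col : Bool) (w : W) :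
    nbrCount (joinGraph G H) (Sum.elim g h) col (Sum.inr w) =
      {v | g v = col}.ncard + nbrCount H h col w := by
  simp [nbrCount, Set.ncard_sum, joinGraph_adj_inr_inr, (joinGraph_adj_inl_inr G H _ w).symm]

theorem stmt_16 {V W : Type*} [Fintype V] [Fintype W]
    (G : SimpleGraph V) (H : SimpleGraph W)
    (g : V → Bool) (hg : IsQNBC G g)
    (hgbal : {v : V | g v = true}.ncard = {v : V | g v = false}.ncard)
    (h : W → Bool) (hh : IsQNBC H h)
    (hhbal : {w : W | h w = true}.ncard = {w : W | h w = false}.ncard) :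
    ∃ c : V ⊕ W → Bool, IsQNBC (joinGraph G H) c := by
  refine ⟨Sum.elim g h, ?_, ?_⟩
  · rintro (v | w)
    · simpa [nbrCount_joinGraph_inl, hhbal] using hg.1 v
    · simpa [nbrCount_joinGraph_inr, hgbal] using hh.1 w
  · obtain ⟨v, hv⟩ := hg.2
    exact ⟨Sum.inl v, by simpa [nbrCount_joinGraph_inl, hhbal] using hv⟩
end

section
/- Every finite simple graph G is an induced subgraph of some finite simple graph H that admits a quasi neighborhood balanced coloring; consequently, the class of quasi neighborhood balanced colored graphs is not hereditary. -/
open SimpleGraph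

/-- In the blow-up of `G` that doubles every vertex into a red and a blue copy, together with a
disjoint bichromatic edge, a doubled vertex sees one vertex of each color per neighbor in `G`. -/
theorem nbrCount_doubling_inl {V : Type*} (G : SimpleGraph V) (col : Bool) (x : V × Bool) :
    nbrCount (G.comap Prod.fst ⊕g (⊤ : SimpleGraph Bool)) (Sum.elim Prod.snd id) col (Sum.inl x) =
      (G.neighborSet x.1).ncard := by
  have hinj : Function.Injective fun u : V => (Sum.inl (u, col) : (V × Bool) ⊕ Bool) :=
    fun a b h => by simpa using h
  rw [← Set.ncard_image_of_injective _ hinj, nbrCount]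
  congr 1
  ext (⟨u, d⟩ | d) <;> simp [eq_comm]

/-- An end of the added bichromatic edge sees exactly one vertex, of the opposite color. -/
theorem nbrCount_doubling_inr {V : Type*} (G : SimpleGraph V) (col b : Bool) :
    nbrCount (G.comap Prod.fst ⊕g (⊤ : SimpleGraph Bool)) (Sum.elim Prod.snd id) col (Sum.inr b) =
      if col = b then 0 else 1 := by
  have hset : {u | (G.comap Prod.fst ⊕g (⊤ : SimpleGraph Bool)).Adj (Sum.inr b) u ∧
      Sum.elim Prod.snd id u = col} = if col = b then ∅ else {Sum.inr col} := by
    ext (⟨u, d⟩ | d) <;> cases b <;> cases col <;> simp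
  rw [nbrCount, hset]
  split_ifs <;> simp

theorem stmt_19 {V : Type} [Fintype V] (G : SimpleGraph V) :
    ∃ (W : Type) (_ : Fintype W) (H : SimpleGraph W) (f : V ↪ W),
      (∀ u v : V, H.Adj (f u) (f v) ↔ G.Adj u v) ∧
        ∃ c : W → Bool, IsQNBC H c := by
  refine ⟨(V × Bool) ⊕ Bool, inferInstance, G.comap Prod.fst ⊕g ⊤,
    ⟨fun v => Sum.inl (v, true), fun a b h => by simpa using h⟩, fun u v => Iff.rfl,
    Sum.elim Prod.snd id, ?_, Sum.inr true, ?_⟩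
  · rintro (x | b)
    · simp [nbrCount_doubling_inl]
    · cases b <;> simp [nbrCount_doubling_inr]
  · simp [nbrCount_doubling_inr]
end
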